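/- Let V, a, b, c, d, K₁₁, K₁₂, K₂₂, B¹, B², U : ℝ² → ℝ be smooth, let H(q,p) = ½(p₁² + p₂²) + V(q), and let G(q,p) = a p₁³ + 3b p₁²p₂ + 3c p₁p₂² + d p₂³ + K₁₁ p₁² + 2K₁₂ p₁p₂ + K₂₂ p₂² + B¹ p₁ + B² p₂ + U, where all coefficient functions are evaluated at q. Then {H,G} = 0 at every point of ℝ² × ℝ² if and only if the following five systems hold at every point q ∈ ℝ²: (i) ∂₁a = 0, ∂₂a + 3∂₁b = 0, ∂₂b + ∂₁c = 0, 3∂₂c + ∂₁d = 0, ∂₂d = 0; (ii) ∂₁K₁₁ = 0, ∂₂K₁₁ + 2∂₁K₁₂ = 0, ∂₁K₂₂ + 2∂₂K₁₂ = 0, ∂₂K₂₂ = 0; (iii) ∂₁B¹ = 3(a ∂₁V + b ∂₂V), ½(∂₁B² + ∂₂B¹) = 3(b ∂₁V + c ∂₂V), ∂₂B² = 3(c ∂₁V + d ∂₂V); (iv) ∂₁U = 2(K₁₁ ∂₁V + K₁₂ ∂₂V), ∂₂U = 2(K₁₂ ∂₁V + K₂₂ ∂₂V); (v) B¹ ∂₁V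 + B² ∂₂V = 0. -/

import Mathlib

/- STATEMENT 3: The Poisson bracket {H,G} of the natural Hamiltonian with the general
cubic-in-momenta function G vanishes identically iff the five systems of determining
equations (Killing equations of valence three and two, the recursion equation, the
dU equation, and the compatibility condition) hold. -/

noncomputable section

/-- Partial derivative with respect to q₁. -/
def pd1 (f : ℝ × ℝ → ℝ) (q : ℝ × ℝ) : ℝ := fderiv ℝ f q (1, 0)

/-- Partial derivative with respect to q₂. -/
def pd2 (f : ℝ × ℝ → ℝ) (q : ℝ × ℝ) : ℝ := fderiv ℝ f q (0, 1)

/-- Canonical Poisson bracket on the phase space ℝ² × ℝ². -/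
def poissonBracket (F G : (ℝ × ℝ) × (ℝ × ℝ) → ℝ) (z : (ℝ × ℝ) × (ℝ × ℝ)) : ℝ :=
  fderiv ℝ F z ((1, 0), (0, 0)) * fderiv ℝ G z ((0, 0), (1, 0)) -
  fderiv ℝ F z ((0, 0), (1, 0)) * fderiv ℝ G z ((1, 0), (0, 0)) +
  fderiv ℝ F z ((0, 1), (0, 0)) * fderiv ℝ G z ((0, 0), (0, 1)) -
  fderiv ℝ F z ((0, 0), (0, 1)) * fderiv ℝ G z ((0, 1), (0, 0))

/-- A real quartic polynomial that vanishes identically has zero coefficients. -/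
theorem quartic_coeff_eq_zero {c₀ c₁ c₂ c₃ c₄ : ℝ}
    (h : ∀ x : ℝ, c₀ + c₁ * x + c₂ * x ^ 2 + c₃ * x ^ 3 + c₄ * x ^ 4 = 0) :
    c₀ = 0 ∧ c₁ = 0 ∧ c₂ = 0 ∧ c₃ = 0 ∧ c₄ = 0 := by
  have h0 := h 0
  have h1 := h 1
  have h2 := h (-1)
  have h3 := h 2
  have h4 := h (-2)
  norm_num at h0 h1 h2 h3 h4
  refine ⟨?_, ?_, ?_, ?_, ?_⟩ <;> linarith

/-- The differential of a function of the position, pulled back to the phase space. -/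
theorem hasFDerivAt_comp_fst {f : ℝ × ℝ → ℝ} (hf : ContDiff ℝ (⊤ : ℕ∞) f)
    (z : (ℝ × ℝ) × (ℝ × ℝ)) :
    HasFDerivAt (fun z : (ℝ × ℝ) × (ℝ × ℝ) => f z.1)
      ((fderiv ℝ f z.1).comp (ContinuousLinearMap.fst ℝ (ℝ × ℝ) (ℝ × ℝ))) z :=
  ((hf.differentiable (by simp)) z.1).hasFDerivAt.comp z hasFDerivAt_fst

/-- The bracket of a natural Hamiltonian with a function cubic in the momenta, expanded in
powers of the momenta. -/
theorem poissonBracket_natural_cubic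
    {V a b c d K₁₁ K₁₂ K₂₂ B₁ B₂ U : ℝ × ℝ → ℝ}
    (hV : ContDiff ℝ (⊤ : ℕ∞) V) (ha : ContDiff ℝ (⊤ : ℕ∞) a)
    (hb : ContDiff ℝ (⊤ : ℕ∞) b) (hc : ContDiff ℝ (⊤ : ℕ∞) c)
    (hd : ContDiff ℝ (⊤ : ℕ∞) d) (hK₁₁ : ContDiff ℝ (⊤ : ℕ∞) K₁₁)
    (hK₁₂ : ContDiff ℝ (⊤ : ℕ∞) K₁₂) (hK₂₂ : ContDiff ℝ (⊤ : ℕ∞) K₂₂)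
    (hB₁ : ContDiff ℝ (⊤ : ℕ∞) B₁) (hB₂ : ContDiff ℝ (⊤ : ℕ∞) B₂)
    (hU : ContDiff ℝ (⊤ : ℕ∞) U) (q : ℝ × ℝ) (x y : ℝ) :
    poissonBracket (fun z => (z.2.1 ^ 2 + z.2.2 ^ 2) / 2 + V z.1)
      (fun z =>
        a z.1 * z.2.1 ^ 3 + 3 * b z.1 * z.2.1 ^ 2 * z.2.2 +
        3 * c z.1 * z.2.1 * z.2.2 ^ 2 + d z.1 * z.2.2 ^ 3 +
        K₁₁ z.1 * z.2.1 ^ 2 + 2 * K₁₂ z.1 * z.2.1 * z.2.2 + K₂₂ z.1 * z.2.2 ^ 2 +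
        B₁ z.1 * z.2.1 + B₂ z.1 * z.2.2 + U z.1) (q, (x, y)) =
      ((B₁ q * pd1 V q + B₂ q * pd2 V q) +
        (2 * (K₁₂ q * pd1 V q + K₂₂ q * pd2 V q) - pd2 U q) * y +
        (3 * (c q * pd1 V q + d q * pd2 V q) - pd2 B₂ q) * y ^ 2 +
        (-pd2 K₂₂ q) * y ^ 3 + (-pd2 d q) * y ^ 4) +
      ((2 * (K₁₁ q * pd1 V q + K₁₂ q * pd2 V q) - pd1 U q) +
        (6 * (b q * pd1 V q + c q * pd2 V q) - (pd1 B₂ q + pd2 B₁ q)) * y +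
        (-(pd1 K₂₂ q + 2 * pd2 K₁₂ q)) * y ^ 2 +
        (-(3 * pd2 c q + pd1 d q)) * y ^ 3 + 0 * y ^ 4) * x +
      ((3 * (a q * pd1 V q + b q * pd2 V q) - pd1 B₁ q) +
        (-(pd2 K₁₁ q + 2 * pd1 K₁₂ q)) * y +
        (-(3 * (pd2 b q + pd1 c q))) * y ^ 2 + 0 * y ^ 3 + 0 * y ^ 4) * x ^ 2 +
      (-pd1 K₁₁ q + (-(pd2 a q + 3 * pd1 b q)) * y + 0 * y ^ 2 + 0 * y ^ 3 + 0 * y ^ 4) * x ^ 3 +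
      (-pd1 a q) * x ^ 4 := by
  have hx : HasFDerivAt (fun z : (ℝ × ℝ) × (ℝ × ℝ) => z.2.1)
      ((ContinuousLinearMap.fst ℝ ℝ ℝ).comp (ContinuousLinearMap.snd ℝ (ℝ × ℝ) (ℝ × ℝ)))
      (q, (x, y)) :=
    ((ContinuousLinearMap.fst ℝ ℝ ℝ).comp
      (ContinuousLinearMap.snd ℝ (ℝ × ℝ) (ℝ × ℝ))).hasFDerivAt
  have hy : HasFDerivAt (fun z : (ℝ × ℝ) × (ℝ × ℝ) => z.2.2)
      ((ContinuousLinearMap.snd ℝ ℝ ℝ).comp (ContinuousLinearMap.snd ℝ (ℝ × ℝ) (ℝ × ℝ)))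
      (q, (x, y)) :=
    ((ContinuousLinearMap.snd ℝ ℝ ℝ).comp
      (ContinuousLinearMap.snd ℝ (ℝ × ℝ) (ℝ × ℝ))).hasFDerivAt
  have D {f : ℝ × ℝ → ℝ} (hf : ContDiff ℝ (⊤ : ℕ∞) f) := hasFDerivAt_comp_fst hf (q, (x, y))
  have hH := (((hx.pow 2).add (hy.pow 2)).mul_const (2⁻¹ : ℝ)).add (D hV)
  have hG := ((((((((((D ha).mul (hx.pow 3)).add
    ((((D hb).const_mul 3).mul (hx.pow 2)).mul hy)).add
    ((((D hc).const_mul 3).mul hx).mul (hy.pow 2))).add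
    ((D hd).mul (hy.pow 3))).add
    ((D hK₁₁).mul (hx.pow 2))).add
    ((((D hK₁₂).const_mul 2).mul hx).mul hy)).add
    ((D hK₂₂).mul (hy.pow 2))).add
    ((D hB₁).mul hx)).add
    ((D hB₂).mul hy)).add (D hU)
  have hH' := HasFDerivAt.fderiv
    (f := fun z : (ℝ × ℝ) × (ℝ × ℝ) => (z.2.1 ^ 2 + z.2.2 ^ 2) / 2 + V z.1) hH
  have hG' := HasFDerivAt.fderiv
    (f := fun z : (ℝ × ℝ) × (ℝ × ℝ) =>
        a z.1 * z.2.1 ^ 3 + 3 * b z.1 * z.2.1 ^ 2 * z.2.2 +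
        3 * c z.1 * z.2.1 * z.2.2 ^ 2 + d z.1 * z.2.2 ^ 3 +
        K₁₁ z.1 * z.2.1 ^ 2 + 2 * K₁₂ z.1 * z.2.1 * z.2.2 + K₂₂ z.1 * z.2.2 ^ 2 +
        B₁ z.1 * z.2.1 + B₂ z.1 * z.2.2 + U z.1) hG
  unfold poissonBracket
  rw [hH', hG']
  have hz : ((0, 0) : ℝ × ℝ) = 0 := rfl
  simp [pd1, pd2, hz]
  ring

theorem cubic_first_integral_determining_equations
    (V a b c d K₁₁ K₁₂ K₂₂ B₁ B₂ U : ℝ × ℝ → ℝ)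
    (hV : ContDiff ℝ (⊤ : ℕ∞) V) (ha : ContDiff ℝ (⊤ : ℕ∞) a)
    (hb : ContDiff ℝ (⊤ : ℕ∞) b) (hc : ContDiff ℝ (⊤ : ℕ∞) c)
    (hd : ContDiff ℝ (⊤ : ℕ∞) d) (hK₁₁ : ContDiff ℝ (⊤ : ℕ∞) K₁₁)
    (hK₁₂ : ContDiff ℝ (⊤ : ℕ∞) K₁₂) (hK₂₂ : ContDiff ℝ (⊤ : ℕ∞) K₂₂)
    (hB₁ : ContDiff ℝ (⊤ : ℕ∞) B₁) (hB₂ : ContDiff ℝ (⊤ : ℕ∞) B₂)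
    (hU : ContDiff ℝ (⊤ : ℕ∞) U)
    (H G : (ℝ × ℝ) × (ℝ × ℝ) → ℝ)
    (hH : H = fun z => (z.2.1 ^ 2 + z.2.2 ^ 2) / 2 + V z.1)
    (hG : G = fun z =>
      a z.1 * z.2.1 ^ 3 + 3 * b z.1 * z.2.1 ^ 2 * z.2.2 +
      3 * c z.1 * z.2.1 * z.2.2 ^ 2 + d z.1 * z.2.2 ^ 3 +
      K₁₁ z.1 * z.2.1 ^ 2 + 2 * K₁₂ z.1 * z.2.1 * z.2.2 + K₂₂ z.1 * z.2.2 ^ 2 +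
      B₁ z.1 * z.2.1 + B₂ z.1 * z.2.2 + U z.1) :
    (∀ z, poissonBracket H G z = 0) ↔
    (∀ q : ℝ × ℝ,
      -- (i) valence-three Killing tensor equations
      (pd1 a q = 0 ∧ pd2 a q + 3 * pd1 b q = 0 ∧ pd2 b q + pd1 c q = 0 ∧
        3 * pd2 c q + pd1 d q = 0 ∧ pd2 d q = 0) ∧
      -- (ii) valence-two Killing tensor equations
      (pd1 K₁₁ q = 0 ∧ pd2 K₁₁ q + 2 * pd1 K₁₂ q = 0 ∧
        pd1 K₂₂ q + 2 * pd2 K₁₂ q = 0 ∧ pd2 K₂₂ q = 0) ∧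
      -- (iii) recursion equation [B,g] = 3 L dV
      (pd1 B₁ q = 3 * (a q * pd1 V q + b q * pd2 V q) ∧
        (pd1 B₂ q + pd2 B₁ q) / 2 = 3 * (b q * pd1 V q + c q * pd2 V q) ∧
        pd2 B₂ q = 3 * (c q * pd1 V q + d q * pd2 V q)) ∧
      -- (iv) dU g = 2 K dV
      (pd1 U q = 2 * (K₁₁ q * pd1 V q + K₁₂ q * pd2 V q) ∧
        pd2 U q = 2 * (K₁₂ q * pd1 V q + K₂₂ q * pd2 V q)) ∧
      -- (v) B(V) = 0
      (B₁ q * pd1 V q + B₂ q * pd2 V q = 0)) := by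
  subst hH hG
  have key := poissonBracket_natural_cubic hV ha hb hc hd hK₁₁ hK₁₂ hK₂₂ hB₁ hB₂ hU
  constructor
  · intro h q
    have hpoly (x y : ℝ) := (key q x y).symm.trans (h (q, (x, y)))
    have hcoeff (y : ℝ) := quartic_coeff_eq_zero (fun x => hpoly x y)
    obtain ⟨e00, e01, e02, e03, e04⟩ := quartic_coeff_eq_zero fun y => (hcoeff y).1
    obtain ⟨e10, e11, e12, e13, -⟩ := quartic_coeff_eq_zero fun y => (hcoeff y).2.1
    obtain ⟨e20, e21, e22, -, -⟩ := quartic_coeff_eq_zero fun y => (hcoeff y).2.2.1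
    obtain ⟨e30, e31, -, -, -⟩ := quartic_coeff_eq_zero fun y => (hcoeff y).2.2.2.1
    have e40 := (hcoeff 0).2.2.2.2
    refine ⟨⟨?_, ?_, ?_, ?_, ?_⟩, ⟨?_, ?_, ?_, ?_⟩, ⟨?_, ?_, ?_⟩, ⟨?_, ?_⟩, ?_⟩ <;> linarith
  · rintro h ⟨q, x, y⟩
    obtain ⟨⟨h1, h2, h3, h4, h5⟩, ⟨k1, k2, k3, k4⟩, ⟨r1, r2, r3⟩, ⟨u1, u2⟩, hv⟩ := h q
    rw [key q x y]
    linear_combination hv - u2 * y - r3 * y ^ 2 - k4 * y ^ 3 - h5 * y ^ 4 - u1 * x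
      - 2 * r2 * x * y - k3 * x * y ^ 2 - h4 * x * y ^ 3 - r1 * x ^ 2 - k2 * x ^ 2 * y
      - 3 * h3 * x ^ 2 * y ^ 2 - k1 * x ^ 3 - h2 * x ^ 3 * y - h1 * x ^ 4
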